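/- arXiv:2403.05942 — 7 statements merged into one kernel-verified Lean document; each statement's English description precedes it below -/
import Mathlib

section
/- Let S be a finitely generated commutative (additive) monoid. Then every minimal basis of every ideal of S is a finite set. -/
/-- The ideal of an additive commutative monoid `S` generated by a subset `U`,
namely `{u + s : u ∈ U, s ∈ S}`. -/
def idealGen {S : Type*} [AddCommMonoid S] (U : Set S) : Set S :=
  {x | ∃ u ∈ U, ∃ s : S, x = u + s}

/-- A subset `I` of an additive commutative monoid is an ideal if `i + s ∈ I`
for every `i ∈ I` and `s ∈ S`. -/
def IsMonoidIdeal {S : Type*} [AddCommMonoid S] (I : Set S) : Prop :=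
  ∀ i ∈ I, ∀ s : S, i + s ∈ I

/-- Let `S` be a finitely generated commutative (additive) monoid. Then every
minimal basis of every ideal of `S` is a finite set. -/
theorem minimal_basis_finite {S : Type*} [AddCommMonoid S]
    (hfg : ∃ r : ℕ, ∃ π : (Fin r → ℕ) →+ S, Function.Surjective π)
    (I : Set S) (hI : IsMonoidIdeal I)
    (B : Set S) (hbasis : idealGen B = I)
    (hmin : ∀ B' : Set S, B' ⊂ B → idealGen B' ≠ I) :
    B.Finite := by
  by_contra hB
  have hB : B.Infinite := hB
  obtain ⟨r, π, hπ⟩ := hfg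
  let f := hB.natEmbedding
  choose g hg using fun n : ℕ => hπ (f n : S)
  obtain ⟨m, n, hmn, hle⟩ := wellQuasiOrdered_le g
  have hne : (f m : S) ≠ f n := fun h => hmn.ne (f.injective (Subtype.ext h))
  have hs : (f n : S) = f m + π (g n - g m) := by
    rw [← hg m, ← map_add, add_tsub_cancel_of_le hle, hg]
  refine hmin (B \ {(f n : S)}) (Set.diff_singleton_ssubset.2 (f n).2) ?_
  rw [← hbasis]
  ext x
  constructor
  · rintro ⟨u, hu, s, rfl⟩
    exact ⟨u, hu.1, s, rfl⟩
  · rintro ⟨u, hu, s, rfl⟩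
    by_cases h : u = f n
    · refine ⟨f m, ⟨(f m).2, hne⟩, π (g n - g m) + s, ?_⟩
      rw [h, ← add_assoc, ← hs]
    · exact ⟨u, ⟨hu, h⟩, s, rfl⟩
end

section
/- Let Δ ⊆ ℝ² be a full-dimensional lattice polygon, i.e. the convex hull of a finite subset of ℤ² whose affine span is all of ℝ². Suppose Δ has exactly 6 width directions, namely wd(Δ) = {u, −u, v, −v, w, −w} with u, −u, v, −v, w, −w pairwise distinct. Then there exist signs ε₁, ε₂, ε₃ ∈ {1, −1} such that ε₁·u + ε₂·v + ε₃·w = 0. -/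
open scoped BigOperators Pointwise

noncomputable section

/-- The pairing `⟨x, v⟩ = ∑ i, x i * v i` between a real vector and an integer vector. -/
def intPairing {n : ℕ} (x : Fin n → ℝ) (v : Fin n → ℤ) : ℝ := ∑ i, x i * (v i : ℝ)

/-- The lattice width of a set `Δ ⊆ ℝ^n` in the direction `v ∈ ℤ^n`:
`max_{x ∈ Δ} ⟨x, v⟩ − min_{x ∈ Δ} ⟨x, v⟩`. -/
def latticeWidthDir {n : ℕ} (Δ : Set (Fin n → ℝ)) (v : Fin n → ℤ) : ℝ :=
  sSup ((fun x => intPairing x v) '' Δ) - sInf ((fun x => intPairing x v) '' Δ)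

/-- The lattice width of `Δ`: the minimum of the widths over all nonzero
integer directions. -/
def latticeWidth {n : ℕ} (Δ : Set (Fin n → ℝ)) : ℝ :=
  sInf {w | ∃ v : Fin n → ℤ, v ≠ 0 ∧ w = latticeWidthDir Δ v}

/-- The set of width directions of `Δ`. -/
def widthDirections {n : ℕ} (Δ : Set (Fin n → ℝ)) : Set (Fin n → ℤ) :=
  {v | v ≠ 0 ∧ latticeWidthDir Δ v = latticeWidth Δ}

/-- The Minkowski difference `Δ_± = Δ − Δ`. -/
def minkDiff {n : ℕ} (Δ : Set (Fin n → ℝ)) : Set (Fin n → ℝ) :=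
  {z | ∃ x ∈ Δ, ∃ y ∈ Δ, z = x - y}

/-- The polar set `K^* = {w : ⟨z, w⟩ ≤ 1 for all z ∈ K}`. -/
def polarSet {n : ℕ} (K : Set (Fin n → ℝ)) : Set (Fin n → ℝ) :=
  {w | ∀ z ∈ K, ∑ i, z i * w i ≤ 1}


lemma w6_signs (g a : ℤ) (h : |a| ≤ |g|) : ∃ e : ℤ, (e = 1 ∨ e = -1) ∧ |e * g - a| = |g| - |a| := by
  rcases le_total 0 g with hg | hg <;> rcases le_total 0 a with ha | ha
  · refine ⟨1, Or.inl rfl, ?_⟩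
    rw [abs_of_nonneg hg, abs_of_nonneg ha] at *
    rw [abs_of_nonneg (by linarith)]; ring
  · refine ⟨-1, Or.inr rfl, ?_⟩
    rw [abs_of_nonneg hg, abs_of_nonpos ha] at *
    rw [abs_of_nonpos (by linarith)]; ring
  · refine ⟨-1, Or.inr rfl, ?_⟩
    rw [abs_of_nonpos hg, abs_of_nonneg ha] at *
    rw [abs_of_nonneg (by linarith)]; ring
  · refine ⟨1, Or.inl rfl, ?_⟩
    rw [abs_of_nonpos hg, abs_of_nonpos ha] at *
    rw [abs_of_nonpos (by linarith)]; ring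

lemma w6_dep {N : (Fin 2 → ℤ) → ℝ} {m : ℝ} (hm : 0 < m)
    (H : ∀ (k a b : ℤ) (z x y : Fin 2 → ℤ), k • z = a • x + b • y →
      (|k| : ℤ) * N z ≤ (|a| : ℤ) * N x + (|b| : ℤ) * N y)
    {u v : Fin 2 → ℤ} (hu : N u = m) (hv : N v = m) (h1 : u ≠ v) (h2 : u ≠ -v) :
    u 0 * v 1 - u 1 * v 0 ≠ 0 := by
  intro h
  have key : ∀ (a b : ℤ) (x y : Fin 2 → ℤ), N x = m → N y = m → a • x = b • y → |a| ≤ |b| := by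
    intro a b x y hx hy e
    have := H a b 0 x y y (by simp [e])
    rw [hx, hy] at this
    simp only [abs_zero, Int.cast_zero, zero_mul, add_zero] at this
    have := le_of_mul_le_mul_right this hm
    exact_mod_cast this
  have e0 : u 0 • v = v 0 • u := by
    ext i; fin_cases i <;> simp <;> linarith
  have e1 : u 1 • v = v 1 • u := by
    ext i; fin_cases i <;> simp <;> linarith
  have a0 := le_antisymm (key _ _ _ _ hv hu e0) (key _ _ _ _ hu hv e0.symm)
  have a1 := le_antisymm (key _ _ _ _ hv hu e1) (key _ _ _ _ hu hv e1.symm)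
  rw [abs_eq_abs] at a0 a1
  have n1 : ¬ (u 0 = v 0 ∧ u 1 = v 1) := fun ⟨p, q⟩ => h1 (by ext i; fin_cases i <;> simp [p, q])
  have n2 : ¬ (u 0 = -v 0 ∧ u 1 = -v 1) := fun ⟨p, q⟩ => h2 (by ext i; fin_cases i <;> simp [p, q])
  rcases a0 with p | p <;> rcases a1 with q | q
  · exact n1 ⟨p, q⟩
  · rw [p, q] at h
    have : v 0 * v 1 = 0 := by linarith
    rcases mul_eq_zero.1 this with t | t
    · exact n2 ⟨by simp [p, t], q⟩
    · exact n1 ⟨p, by simp [q, t]⟩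
  · rw [p, q] at h
    have : v 0 * v 1 = 0 := by linarith
    rcases mul_eq_zero.1 this with t | t
    · exact n1 ⟨by simp [p, t], q⟩
    · exact n2 ⟨p, by simp [q, t]⟩
  · exact n2 ⟨p, q⟩

lemma w6_core {N : (Fin 2 → ℤ) → ℝ} {m : ℝ} (hm : 0 < m)
    (H : ∀ (k a b : ℤ) (z x y : Fin 2 → ℤ), k • z = a • x + b • y →
      (|k| : ℤ) * N z ≤ (|a| : ℤ) * N x + (|b| : ℤ) * N y)
    (hmin : ∀ z, z ≠ 0 → m ≤ N z)
    {u v w : Fin 2 → ℤ} (hu : N u = m) (hv : N v = m)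
    (huv : u 0 * v 1 - u 1 * v 0 ≠ 0)
    (hvw : v 0 * w 1 - v 1 * w 0 ≠ 0)
    (hp : ∀ i, (u i + v i + w i) % 2 = 0)
    (ha : |v 0 * w 1 - v 1 * w 0| ≤ |u 0 * v 1 - u 1 * v 0|)
    (hb : |w 0 * u 1 - w 1 * u 0| ≤ |u 0 * v 1 - u 1 * v 0|) :
    ∃ ε₁ ε₂ ε₃ : ℤ, (ε₁ = 1 ∨ ε₁ = -1) ∧ (ε₂ = 1 ∨ ε₂ = -1) ∧ (ε₃ = 1 ∨ ε₃ = -1) ∧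
      ε₁ • u + ε₂ • v + ε₃ • w = 0 := by
  obtain ⟨e1, he1, h1⟩ := w6_signs _ _ ha
  obtain ⟨e2, he2, h2⟩ := w6_signs _ _ hb
  refine ⟨e1, e2, 1, he1, he2, Or.inl rfl, ?_⟩
  set g := u 0 * v 1 - u 1 * v 0 with hg
  set a := v 0 * w 1 - v 1 * w 0 with ha'
  set b := w 0 * u 1 - w 1 * u 0 with hb'
  let z : Fin 2 → ℤ := fun i => (e1 * u i + e2 * v i + w i) / 2
  have hz : ∀ i, 2 * z i = e1 * u i + e2 * v i + w i := by
    intro i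
    have := hp i
    simp only [z]
    rcases he1 with rfl | rfl <;> rcases he2 with rfl | rfl <;> omega
  have hrel : (2 * g) • z = (e1 * g - a) • u + (e2 * g - b) • v := by
    ext i
    have h0 := hz i
    have : (2 * g) * z i = g * (e1 * u i + e2 * v i + w i) := by rw [← h0]; ring
    simp only [Pi.smul_apply, Pi.add_apply, smul_eq_mul]
    rw [this]
    fin_cases i <;> simp [hg, ha', hb'] <;> ring
  have hN := H _ _ _ _ _ _ hrel
  rw [h1, h2, hu, hv, abs_mul] at hN
  have hgpos : (0:ℝ) < (|g| : ℤ) := by exact_mod_cast abs_pos.2 huv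
  have hapos : (0:ℝ) < (|a| : ℤ) := by exact_mod_cast abs_pos.2 hvw
  have hbpos : (0:ℝ) ≤ (|b| : ℤ) := by exact_mod_cast abs_nonneg b
  have hz0 : z = 0 := by
    by_contra hne
    have := hmin z hne
    rw [Int.cast_mul, Int.cast_sub, Int.cast_sub] at hN
    have t : ((|2| : ℤ) : ℝ) = 2 := by norm_num
    rw [t] at hN
    nlinarith [mul_le_mul_of_nonneg_left this hgpos.le, mul_pos hapos hm, mul_nonneg hbpos hm.le]
  ext i
  have := hz i
  rw [hz0] at this
  simp at this ⊢
  linarith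

lemma w6_par {N : (Fin 2 → ℤ) → ℝ} {m : ℝ} (hm : 0 < m)
    (H : ∀ (k a b : ℤ) (z x y : Fin 2 → ℤ), k • z = a • x + b • y →
      (|k| : ℤ) * N z ≤ (|a| : ℤ) * N x + (|b| : ℤ) * N y)
    (hmin : ∀ z, z ≠ 0 → m ≤ N z)
    {u v w : Fin 2 → ℤ}
    (hS : ∀ z, z ≠ 0 → N z = m → z = u ∨ z = -u ∨ z = v ∨ z = -v ∨ z = w ∨ z = -w)
    (hu : N u = m) (hv : N v = m)
    (huv : u 0 * v 1 - u 1 * v 0 ≠ 0) :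
    ¬ ((u 0 - v 0) % 2 = 0 ∧ (u 1 - v 1) % 2 = 0) := by
  rintro ⟨p0, p1⟩
  have key : ∀ e : ℤ, e = 1 ∨ e = -1 → ∃ z : Fin 2 → ℤ, (∀ i, 2 * z i = u i + e * v i) ∧
      (z = w ∨ z = -w) := by
    intro e he
    let z : Fin 2 → ℤ := fun i => (u i + e * v i) / 2
    have hz : ∀ i, 2 * z i = u i + e * v i := by
      intro i
      simp only [z]
      rcases he with rfl | rfl <;> fin_cases i <;> simp <;> omega
    have hz0 : z ≠ 0 := by
      intro h
      have a0 := hz 0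
      have a1 := hz 1
      rw [h] at a0 a1
      simp at a0 a1
      apply huv
      have b0 : u 0 = - (e * v 0) := by linarith
      have b1 : u 1 = - (e * v 1) := by linarith
      rw [b0, b1]; ring
    have hN := H 2 1 e z u v (by ext i; simpa using hz i)
    have he' : |e| = 1 := by rcases he with rfl | rfl <;> simp
    rw [he', hu, hv] at hN
    norm_num at hN
    have hzm : N z = m := le_antisymm (by linarith) (hmin z hz0)
    refine ⟨z, hz, ?_⟩
    have a0 := hz 0
    have a1 := hz 1
    have e0 : e ≠ 0 := by rcases he with rfl | rfl <;> simp
    rcases hS z hz0 hzm with h | h | h | h | h | h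
    · exfalso; rw [h] at a0 a1
      have : e * (u 0 * v 1 - u 1 * v 0) = 0 := by linear_combination u 1 * a0 - u 0 * a1
      rcases mul_eq_zero.1 this with t | t <;> contradiction
    · exfalso; rw [h] at a0 a1
      simp only [Pi.neg_apply] at a0 a1
      have : e * (u 0 * v 1 - u 1 * v 0) = 0 := by linear_combination u 1 * a0 - u 0 * a1
      rcases mul_eq_zero.1 this with t | t <;> contradiction
    · exfalso; rw [h] at a0 a1
      apply huv; linear_combination v 0 * a1 - v 1 * a0
    · exfalso; rw [h] at a0 a1
      simp only [Pi.neg_apply] at a0 a1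
      apply huv; linear_combination v 0 * a1 - v 1 * a0
    · exact Or.inl h
    · exact Or.inr h
  obtain ⟨x, hx, hx'⟩ := key 1 (Or.inl rfl)
  obtain ⟨y, hy, hy'⟩ := key (-1) (Or.inr rfl)
  have x0 := hx 0
  have x1 := hx 1
  have y0 := hy 0
  have y1 := hy 1
  have hxy : x = y ∨ x = -y := by
    rcases hx' with rfl | rfl <;> rcases hy' with rfl | rfl <;> simp
  rcases hxy with rfl | rfl
  · have : v 0 = 0 := by linarith
    have : v 1 = 0 := by linarith
    simp_all
  · simp only [Pi.neg_apply] at x0 x1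
    have : u 0 = 0 := by linarith
    have : u 1 = 0 := by linarith
    simp_all

lemma w6_main {N : (Fin 2 → ℤ) → ℝ} {m : ℝ} (hm : 0 < m)
    (H : ∀ (k a b : ℤ) (z x y : Fin 2 → ℤ), k • z = a • x + b • y →
      (|k| : ℤ) * N z ≤ (|a| : ℤ) * N x + (|b| : ℤ) * N y)
    (hmin : ∀ z, z ≠ 0 → m ≤ N z)
    {u v w : Fin 2 → ℤ}
    (hS : ∀ z, z ≠ 0 → N z = m → z = u ∨ z = -u ∨ z = v ∨ z = -v ∨ z = w ∨ z = -w)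
    (hu : N u = m) (hv : N v = m) (hw : N w = m)
    (h1 : u ≠ v) (h2 : u ≠ -v) (h3 : v ≠ w) (h4 : v ≠ -w) (h5 : w ≠ u) (h6 : w ≠ -u) :
    ∃ ε₁ ε₂ ε₃ : ℤ, (ε₁ = 1 ∨ ε₁ = -1) ∧ (ε₂ = 1 ∨ ε₂ = -1) ∧ (ε₃ = 1 ∨ ε₃ = -1) ∧
      ε₁ • u + ε₂ • v + ε₃ • w = 0 := by
  have duv := w6_dep hm H hu hv h1 h2
  have dvw := w6_dep hm H hv hw h3 h4
  have dwu := w6_dep hm H hw hu h5 h6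
  have puv := w6_par hm H hmin hS hu hv duv
  have pvw := w6_par (w := u) hm H hmin (by intro z a b; have := hS z a b; tauto) hv hw dvw
  have pwu := w6_par (w := v) hm H hmin (by intro z a b; have := hS z a b; tauto) hw hu dwu
  have ev : ∀ x : Fin 2 → ℤ, N x = m → x ≠ 0 → ¬ (x 0 % 2 = 0 ∧ x 1 % 2 = 0) := by
    rintro x hx hx0 ⟨q0, q1⟩
    let z : Fin 2 → ℤ := fun i => x i / 2
    have hz : ∀ i, 2 * z i = x i := by intro i; simp only [z]; fin_cases i <;> simp <;> omega
    have hz0 : z ≠ 0 := by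
      rintro h; apply hx0; ext i; rw [← hz i, h]; simp
    have hN := H 2 1 0 z x x (by ext i; simpa using hz i)
    rw [hx] at hN
    norm_num at hN
    linarith [hmin z hz0]
  have eu := ev u hu (by rintro rfl; simp at duv)
  have ev' := ev v hv (by rintro rfl; simp at duv)
  have ew := ev w hw (by rintro rfl; simp at dvw)
  have hp : ∀ i, (u i + v i + w i) % 2 = 0 := by
    intro i
    fin_cases i <;> simp <;> omega
  by_cases c1 : |v 0 * w 1 - v 1 * w 0| ≤ |u 0 * v 1 - u 1 * v 0| ∧
      |w 0 * u 1 - w 1 * u 0| ≤ |u 0 * v 1 - u 1 * v 0|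
  · exact w6_core hm H hmin hu hv duv dvw hp c1.1 c1.2
  by_cases c2 : |w 0 * u 1 - w 1 * u 0| ≤ |v 0 * w 1 - v 1 * w 0| ∧
      |u 0 * v 1 - u 1 * v 0| ≤ |v 0 * w 1 - v 1 * w 0|
  · obtain ⟨a, b, c, ha, hb, hc, h⟩ := w6_core hm H hmin hv hw dvw dwu
      (by intro i; rw [← hp i]; ring_nf) c2.1 c2.2
    exact ⟨c, a, b, hc, ha, hb, by rw [← h]; abel⟩
  · obtain ⟨a, b, c, ha, hb, hc, h⟩ := w6_core hm H hmin hw hu dwu duv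
      (by intro i; rw [← hp i]; ring_nf) (by omega) (by omega)
    exact ⟨b, c, a, hb, hc, ha, by rw [← h]; abel⟩

lemma w6_pair_rel (p : Fin 2 → ℝ) {k a b : ℤ} {z x y : Fin 2 → ℤ} (h : k • z = a • x + b • y) :
    k * intPairing p z = a * intPairing p x + b * intPairing p y := by
  have h0 := congrFun h 0
  have h1 := congrFun h 1
  simp only [Pi.smul_apply, Pi.add_apply, smul_eq_mul] at h0 h1
  have h0' : (k:ℝ) * z 0 = a * x 0 + b * y 0 := by exact_mod_cast h0
  have h1' : (k:ℝ) * z 1 = a * x 1 + b * y 1 := by exact_mod_cast h1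
  simp only [intPairing, Fin.sum_univ_two]
  linear_combination p 0 * h0' + p 1 * h1'

lemma w6_bdd {Δ : Set (Fin 2 → ℝ)} (hc : IsCompact Δ) (v : Fin 2 → ℤ) :
    IsCompact ((fun x => intPairing x v) '' Δ) := by
  apply hc.image
  unfold intPairing
  fun_prop

lemma w6_ge {Δ : Set (Fin 2 → ℝ)} (hc : IsCompact Δ) (v : Fin 2 → ℤ) {p q : Fin 2 → ℝ}
    (hp : p ∈ Δ) (hq : q ∈ Δ) : |intPairing p v - intPairing q v| ≤ latticeWidthDir Δ v := by
  have h := w6_bdd hc v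
  have a1 := le_csSup h.bddAbove (Set.mem_image_of_mem _ hp)
  have a2 := le_csSup h.bddAbove (Set.mem_image_of_mem _ hq)
  have a3 := csInf_le h.bddBelow (Set.mem_image_of_mem _ hp)
  have a4 := csInf_le h.bddBelow (Set.mem_image_of_mem _ hq)
  unfold latticeWidthDir
  rw [abs_le]; constructor <;> linarith

lemma w6_att {Δ : Set (Fin 2 → ℝ)} (hc : IsCompact Δ) (hne : Δ.Nonempty) (v : Fin 2 → ℤ) :
    ∃ p ∈ Δ, ∃ q ∈ Δ, latticeWidthDir Δ v = intPairing p v - intPairing q v := by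
  have h := w6_bdd hc v
  obtain ⟨p, hp, hp'⟩ := h.sSup_mem (hne.image _)
  obtain ⟨q, hq, hq'⟩ := h.sInf_mem (hne.image _)
  refine ⟨p, hp, q, hq, ?_⟩
  unfold latticeWidthDir
  rw [← hp', ← hq']

lemma w6_H {Δ : Set (Fin 2 → ℝ)} (hc : IsCompact Δ) (hne : Δ.Nonempty)
    (k a b : ℤ) (z x y : Fin 2 → ℤ) (h : k • z = a • x + b • y) :
    (|k| : ℤ) * latticeWidthDir Δ z ≤
      (|a| : ℤ) * latticeWidthDir Δ x + (|b| : ℤ) * latticeWidthDir Δ y := by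
  obtain ⟨p, hp, q, hq, e⟩ := w6_att hc hne z
  have r1 := w6_pair_rel p h
  have r2 := w6_pair_rel q h
  have gx := w6_ge hc x hp hq
  have gy := w6_ge hc y hp hq
  rw [e]
  push_cast
  calc |(k:ℝ)| * (intPairing p z - intPairing q z)
      ≤ |(k:ℝ)| * |intPairing p z - intPairing q z| := by gcongr; exact le_abs_self _
    _ = |a * (intPairing p x - intPairing q x) + b * (intPairing p y - intPairing q y)| := by
        rw [← abs_mul]; congr 1; linear_combination r1 - r2
    _ ≤ |(a:ℝ)| * |intPairing p x - intPairing q x| + |(b:ℝ)| * |intPairing p y - intPairing q y| := by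
        rw [← abs_mul, ← abs_mul]; exact abs_add_le _ _
    _ ≤ _ := by gcongr

/-- If a full-dimensional lattice polygon `Δ ⊆ ℝ²` has exactly six width
directions `{u, −u, v, −v, w, −w}` (pairwise distinct), then after possibly
changing signs, `u + v + w = 0`. -/
theorem widthDirections_six {F : Finset (Fin 2 → ℤ)}
    (Δ : Set (Fin 2 → ℝ))
    (hΔ : Δ = convexHull ℝ ((fun z : Fin 2 → ℤ => fun i => (z i : ℝ)) '' ↑F))
    (hdim : affineSpan ℝ Δ = ⊤)
    (u v w : Fin 2 → ℤ)
    (hdistinct : ([u, -u, v, -v, w, -w] : List (Fin 2 → ℤ)).Nodup)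
    (hwd : widthDirections Δ = {u, -u, v, -v, w, -w}) :
    ∃ ε₁ ε₂ ε₃ : ℤ, (ε₁ = 1 ∨ ε₁ = -1) ∧ (ε₂ = 1 ∨ ε₂ = -1) ∧ (ε₃ = 1 ∨ ε₃ = -1) ∧
      ε₁ • u + ε₂ • v + ε₃ • w = 0 := by
  have hc : IsCompact Δ := by
    rw [hΔ]
    exact (F.finite_toSet.image _).isCompact_convexHull ℝ
  have hne : Δ.Nonempty := by
    rw [Set.nonempty_iff_ne_empty]
    rintro rfl
    rw [AffineSubspace.span_empty] at hdim
    exact AffineSubspace.bot_ne_top ℝ (Fin 2 → ℝ) (Fin 2 → ℝ) hdim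
  have H := w6_H hc hne
  have hnn : ∀ z, 0 ≤ latticeWidthDir Δ z := fun z => by
    obtain ⟨p, hp⟩ := hne
    exact (abs_nonneg _).trans (w6_ge hc z hp hp)
  have hmin : ∀ z, z ≠ 0 → latticeWidth Δ ≤ latticeWidthDir Δ z := by
    intro z hz
    refine csInf_le ⟨0, ?_⟩ ⟨z, hz, rfl⟩
    rintro _ ⟨y, -, rfl⟩
    exact hnn y
  have hmem : ∀ z, z ∈ widthDirections Δ ↔
      (z = u ∨ z = -u ∨ z = v ∨ z = -v ∨ z = w ∨ z = -w) := by
    intro z; rw [hwd]; simp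
  have hu := (hmem u).2 (by simp)
  have hv := (hmem v).2 (by simp)
  have hw := (hmem w).2 (by simp)
  have hm : 0 < latticeWidth Δ := by
    rcases (hu.2 ▸ hnn u : 0 ≤ latticeWidth Δ).lt_or_eq with h | h
    · exact h
    exfalso
    have hfin : (widthDirections Δ).Finite := by rw [hwd]; exact Set.toFinite _
    refine Set.infinite_of_injective_forall_mem (f := fun n : ℕ => ((n : ℤ) + 1) • u) ?_ ?_ hfin
    · intro a b hab
      have := smul_left_injective ℤ hu.1 hab
      simpa using this
    · intro n
      refine ⟨smul_ne_zero (by omega) hu.1, ?_⟩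
      have := H 1 ((n:ℤ)+1) 0 (((n : ℤ) + 1) • u) u u (by simp)
      rw [hu.2, ← h] at this
      simp at this
      rw [← h]
      exact le_antisymm this (hnn _)
  simp only [List.nodup_cons, List.mem_cons, not_or] at hdistinct
  obtain ⟨⟨-, a1, a2, a3, a4, -⟩, -, ⟨-, b1, b2, -⟩, -⟩ := hdistinct
  exact w6_main hm H hmin (fun z hz h => (hmem z).1 ⟨hz, h⟩) hu.2 hv.2 hw.2
    a1 a2 b1 b2 (Ne.symm a3) (fun h => a4 (by rw [h, neg_neg]))
end
end

section
/- Assume 0 < 2p < q, c₁ = 0, and that for some n ≥ 1 the chain q = β₀ > β₁ > β₂ > … > β_{n−1} > β_n = 0 of strict inequalities holds. Then for every i with 0 ≤ i ≤ n−1, β_i·b_i + β_{i+1}·b_{i+1} < q. -/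
/-- Assume `0 < 2p < q`, `c₁ = 0`, and that for some `n ≥ 1` the strict chain
`q = β₀ > β₁ > ⋯ > βₙ₋₁ > βₙ = 0` holds. Then for every `0 ≤ i ≤ n−1` one has
`βᵢ·bᵢ + βᵢ₊₁·bᵢ₊₁ < q`. -/
theorem beta_b_sum_lt (p q : ℤ) (c a b β : ℤ → ℤ)
    (ha₀ : a (-1) = 0) (ha₁ : a 0 = 1)
    (hb₀ : b (-1) = 1) (hb₁ : b 0 = 0)
    (ha : ∀ i : ℤ, 1 ≤ i → a i = c i * a (i - 1) + a (i - 2))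
    (hb : ∀ i : ℤ, 1 ≤ i → b i = c i * b (i - 1) + b (i - 2))
    (hβ : ∀ i : ℤ, -1 ≤ i → β i = (Int.negOnePow i : ℤ) * (a i * q - b i * p))
    (hp : 0 < 2 * p) (hpq : 2 * p < q) (hc₁ : c 1 = 0)
    (n : ℤ) (hn : 1 ≤ n)
    (hchain0 : β 0 = q)
    (hchain : ∀ i : ℤ, 0 ≤ i → i ≤ n - 1 → β (i + 1) < β i)
    (hchainn : β n = 0) :
    ∀ i : ℤ, 0 ≤ i → i ≤ n - 1 → β i * b i + β (i + 1) * b (i + 1) < q := by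
  have hrec : ∀ i : ℤ, 0 ≤ i → β (i + 1) = β (i - 1) - c (i + 1) * β i := by
    intro i hi
    have e1 : i + 1 - 1 = i := by ring
    have e2 : i + 1 - 2 = i - 1 := by ring
    have h1 := ha (i + 1) (by omega)
    have h2 := hb (i + 1) (by omega)
    rw [e1, e2] at h1 h2
    rw [hβ (i + 1) (by omega), hβ (i - 1) (by omega), hβ i (by omega), h1, h2,
      Int.negOnePow_succ, Int.negOnePow_sub, Int.negOnePow_one]
    push_cast
    ring
  have nonneg : ∀ m : ℕ, (m : ℤ) ≤ n → 0 ≤ β (n - m) := by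
    intro m
    induction m with
    | zero => intro _; simp [hchainn]
    | succ k ih =>
      intro hk
      push_cast at hk ⊢
      have h1 := ih (by omega)
      have h2 := hchain (n - (k + 1)) (by omega) (by omega)
      have e : n - ((k : ℤ) + 1) + 1 = n - k := by ring
      rw [e] at h2
      omega
  have nonneg' : ∀ i : ℤ, 0 ≤ i → i ≤ n → 0 ≤ β i := by
    intro i h0 h1
    have := nonneg (n - i).toNat (by omega)
    rwa [Int.toNat_of_nonneg (by omega), sub_sub_cancel] at this
  have hbm : β (-1) = p := by
    rw [hβ (-1) le_rfl, ha₀, hb₀]; simp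
  have hβ1 : β 1 = p := by
    have := hrec 0 le_rfl
    norm_num at this
    rw [this, hbm, hc₁]; ring
  have hb1 : b 1 = 1 := by
    have := hb 1 le_rfl
    norm_num at this
    rw [this, hc₁, hb₀]; ring
  have key : ∀ k : ℕ, (k : ℤ) ≤ n - 1 →
      β k * b (k + 1) + β (k + 1) * b k = q ∧ b k < b (k + 1) ∧ 0 ≤ b k ∧ (0 < k → 0 < b k) := by
    intro k
    induction k with
    | zero => intro _; simp [hb1, hb₁, hchain0]
    | succ k ih =>
      intro hk
      push_cast at hk ⊢
      obtain ⟨h1, h2, h3, h4⟩ := ih (by omega)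
      have r := hrec ((k : ℤ) + 1) (by omega)
      have rb := hb ((k : ℤ) + 1 + 1) (by omega)
      have e1 : (k : ℤ) + 1 + 1 - 1 = k + 1 := by ring
      have e2 : (k : ℤ) + 1 + 1 - 2 = k := by ring
      have e3 : (k : ℤ) + 1 - 1 = k := by ring
      rw [e1, e2] at rb
      rw [e3] at r
      have d1 := hchain k (by omega) (by omega)
      have d2 := hchain ((k : ℤ) + 1) (by omega) (by omega)
      have n2 := nonneg' ((k : ℤ) + 1 + 1) (by omega) (by omega)
      refine ⟨?_, ?_, by omega, fun _ => by omega⟩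
      · rw [rb, r, ← h1]; ring
      · rw [rb]
        have hc : 1 ≤ c ((k : ℤ) + 1 + 1) := by
          by_contra hcon
          have : c ((k : ℤ) + 1 + 1) ≤ 0 := by omega
          nlinarith
        rcases Nat.eq_zero_or_pos k with rfl | hkpos
        · norm_num at *
          rw [hb1, hb₁]
          rw [hβ1] at d2 r
          rw [hchain0] at r
          by_contra hcon
          have : c 2 = 1 := by omega
          rw [this] at r
          omega
        · have hk0 : 0 < b k := h4 hkpos
          nlinarith
  intro i h0 h1
  obtain ⟨k, rfl⟩ := Int.eq_ofNat_of_zero_le h0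
  obtain ⟨h3, h4, h5, h6⟩ := key k h1
  have := hchain k h0 h1
  nlinarith [mul_pos (sub_pos.2 this) (sub_pos.2 h4)]
end

section
/- Assume q ≠ 0. Then for every j ≥ 0 the following identity of rational numbers holds: (2β_j·b_j/q − 1)·(2β_{j+2}·b_{j+2}/q − 1) − ((β_{j+2}·b_j + β_j·b_{j+2})/q − 1)² = (c_{j+2}²/q)·(2β_{j+1}·b_{j+1} − q). -/
/-- Assume `q ≠ 0`. Then for every `j ≥ 0` the following identity of rational
numbers holds:
`(2βⱼbⱼ/q − 1)(2βⱼ₊₂bⱼ₊₂/q − 1) − ((βⱼ₊₂bⱼ + βⱼbⱼ₊₂)/q − 1)² = (cⱼ₊₂²/q)(2βⱼ₊₁bⱼ₊₁ − q)`. -/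
theorem determinant_identity (p q : ℤ) (c a b β : ℤ → ℤ)
    (ha₀ : a (-1) = 0) (ha₁ : a 0 = 1)
    (hb₀ : b (-1) = 1) (hb₁ : b 0 = 0)
    (ha : ∀ i : ℤ, 1 ≤ i → a i = c i * a (i - 1) + a (i - 2))
    (hb : ∀ i : ℤ, 1 ≤ i → b i = c i * b (i - 1) + b (i - 2))
    (hβ : ∀ i : ℤ, -1 ≤ i → β i = (Int.negOnePow i : ℤ) * (a i * q - b i * p))
    (hq : q ≠ 0) :
    ∀ j : ℤ, 0 ≤ j →
      (2 * (β j : ℚ) * (b j : ℚ) / (q : ℚ) - 1) *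
          (2 * (β (j + 2) : ℚ) * (b (j + 2) : ℚ) / (q : ℚ) - 1) -
        (((β (j + 2) : ℚ) * (b j : ℚ) + (β j : ℚ) * (b (j + 2) : ℚ)) / (q : ℚ) - 1) ^ 2 =
      ((c (j + 2) : ℚ) ^ 2 / (q : ℚ)) *
        (2 * (β (j + 1) : ℚ) * (b (j + 1) : ℚ) - (q : ℚ)) := by
  have hbr : ∀ j : ℤ, 0 ≤ j + 1 → b (j + 2) = c (j + 2) * b (j + 1) + b j := by
    intro j hj
    have h := hb (j + 2) (by omega)
    rwa [show j + 2 - 1 = j + 1 by ring, show j + 2 - 2 = j by ring] at h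
  have har : ∀ j : ℤ, 0 ≤ j + 1 → a (j + 2) = c (j + 2) * a (j + 1) + a j := by
    intro j hj
    have h := ha (j + 2) (by omega)
    rwa [show j + 2 - 1 = j + 1 by ring, show j + 2 - 2 = j by ring] at h
  have hβr : ∀ j : ℤ, 0 ≤ j + 1 → β (j + 2) = -c (j + 2) * β (j + 1) + β j := by
    intro j hj
    rw [hβ (j + 2) (by omega), hβ (j + 1) (by omega), hβ j (by omega), hbr j hj, har j hj,
      show j + 2 = j + 1 + 1 by ring, Int.negOnePow_succ, Int.negOnePow_succ]
    push_cast
    ring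
  have hβ0 : β 0 = q := by
    rw [hβ 0 (by omega), ha₁, hb₁]
    simp
  have hW : ∀ n : ℕ, β ((n : ℤ) + 1) * b n + β n * b ((n : ℤ) + 1) = q := by
    intro n
    induction n with
    | zero =>
      have h := hb 1 le_rfl
      norm_num [hb₀, hb₁] at h
      simp [hb₁, hβ0, h]
    | succ k ih =>
      have h1 := hbr k (by omega)
      have h2 := hβr k (by omega)
      push_cast
      rw [show (k : ℤ) + 1 + 1 = k + 2 by ring, h1, h2]
      linear_combination ih
  intro j hj
  have hw : β (j + 1) * b j + β j * b (j + 1) = q := by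
    obtain ⟨n, rfl⟩ := Int.eq_ofNat_of_zero_le hj
    exact hW n
  have hqq : (q : ℚ) ≠ 0 := by exact_mod_cast hq
  have hw' : (β (j + 1) : ℚ) * b j + β j * b (j + 1) = q := by exact_mod_cast hw
  rw [hbr j (by omega), hβr j (by omega)]
  push_cast
  generalize (β (j + 1) : ℚ) = x at *
  generalize (β j : ℚ) = y at *
  generalize (b (j + 1) : ℚ) = u at *
  generalize (b j : ℚ) = v at *
  generalize (c (j + 2) : ℚ) = d at *
  generalize (q : ℚ) = r at *
  have key : (2 * y * v - r) * (2 * (-d * x + y) * (d * u + v) - r)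
      - ((-d * x + y) * v + y * (d * u + v) - r) ^ 2 = r * d ^ 2 * (2 * x * u - r) := by
    linear_combination (-d ^ 2 * (x * v + y * u + r)) * hw'
  have e : d ^ 2 / r * (2 * x * u - r) = (r * d ^ 2 * (2 * x * u - r)) / r ^ 2 := by
    field_simp
  rw [e, ← key]
  field_simp
end

section
/- Let p, q, b, β be positive integers, let a be a nonnegative integer, and let ε ∈ {1, −1}. Assume gcd(p, q) = 1, b·p = a·q + ε·β, and q = 2·b·β. Then β = b, q = 2·b², and p = 2·a·b + ε. -/
/-- Let `p, q, b, β` be positive integers, `a` a nonnegative integer and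
`ε ∈ {1, −1}`. If `gcd(p, q) = 1`, `b·p = a·q + ε·β` and `q = 2·b·β`, then
`β = b`, `q = 2·b²` and `p = 2·a·b + ε`. -/
theorem square_case (p q b β a ε : ℤ)
    (hp : 0 < p) (hq : 0 < q) (hb : 0 < b) (hβ : 0 < β) (ha : 0 ≤ a)
    (hε : ε = 1 ∨ ε = -1)
    (hgcd : Int.gcd p q = 1)
    (h₁ : b * p = a * q + ε * β)
    (h₂ : q = 2 * b * β) :
    β = b ∧ q = 2 * b ^ 2 ∧ p = 2 * a * b + ε := by
  have hc : IsCoprime p q := Int.isCoprime_iff_gcd_eq_one.mpr hgcd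
  have hβq : β ∣ q := ⟨2 * b, by rw [h₂]; ring⟩
  have hc' : IsCoprime β p := (hc.of_isCoprime_of_dvd_right hβq).symm
  have h3 : b * p = β * (2 * a * b + ε) := by rw [h₁, h₂]; ring
  have d1 : β ∣ b := hc'.dvd_of_dvd_mul_right ⟨_, h3⟩
  have d2 : b ∣ β := by
    rcases hε with rfl | rfl
    · exact ⟨p - 2 * a * β, by linarith⟩
    · exact ⟨2 * a * β - p, by linarith⟩
  have e : β = b := Int.dvd_antisymm hβ.le hb.le d1 d2
  subst e
  refine ⟨rfl, by rw [h₂]; ring, ?_⟩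
  exact mul_left_cancel₀ hβ.ne' h3
end

section
/- Let k be a field and let L ⊆ ℤ^r be a saturated subgroup, i.e. whenever m ∈ ℤ^r and d·m ∈ L for some nonzero integer d, then m ∈ L. Let 𝓑 ⊆ ℕ^r × ℕ^r be a set that generates, as an additive monoid, the monoid M_L := {(a, b) ∈ ℕ^r × ℕ^r : a − b ∈ L}. Then the lattice ideal I_L ⊆ k[x₁,…,x_r] equals the ideal generated by the binomials x^a − x^b for (a, b) ∈ 𝓑. -/
open MvPolynomial

noncomputable section

/-- The monomial `x^a = x₁^{a₁} ⋯ x_r^{a_r}`. -/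
def monom (k : Type*) [CommRing k] {r : ℕ} (a : Fin r → ℕ) :
    MvPolynomial (Fin r) k :=
  ∏ i, X i ^ a i

/-- The lattice ideal of a subgroup `L ⊆ ℤ^r`: the ideal generated by the
binomials `x^{m⁺} − x^{m⁻}` for `m ∈ L`. -/
def latticeIdeal (k : Type*) [CommRing k] {r : ℕ} (L : AddSubgroup (Fin r → ℤ)) :
    Ideal (MvPolynomial (Fin r) k) :=
  Ideal.span {f | ∃ m ∈ L,
    f = monom k (fun i => (m i).toNat) - monom k (fun i => (-(m i)).toNat)}

/-- Let `L ⊆ ℤ^r` be a saturated subgroup and let `𝓑 ⊆ ℕ^r × ℕ^r` generate, as an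
additive monoid, the monoid `M_L = {(a, b) : a − b ∈ L}`. Then the lattice ideal
`I_L` equals the ideal generated by the binomials `x^a − x^b` for `(a, b) ∈ 𝓑`. -/
theorem latticeIdeal_eq_span_of_monoid_gens (k : Type*) [Field k] (r : ℕ)
    (L : AddSubgroup (Fin r → ℤ))
    (hsat : ∀ (m : Fin r → ℤ) (d : ℤ), d ≠ 0 → d • m ∈ L → m ∈ L)
    (𝓑 : Set ((Fin r → ℕ) × (Fin r → ℕ)))
    (hgen : (AddSubmonoid.closure 𝓑 : Set ((Fin r → ℕ) × (Fin r → ℕ))) =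
      {p | (fun i => (p.1 i : ℤ) - (p.2 i : ℤ)) ∈ L}) :
    latticeIdeal k L =
      Ideal.span {f | ∃ p ∈ 𝓑, f = monom k p.1 - monom k p.2} := by
  have hadd : ∀ a b : Fin r → ℕ, monom k (a + b) = monom k a * monom k b := by
    intro a b
    simp [monom, pow_add, Finset.prod_mul_distrib]
  apply le_antisymm
  · refine Ideal.span_le.2 ?_
    rintro f ⟨m, hm, rfl⟩
    have key : ∀ p ∈ AddSubmonoid.closure 𝓑, monom k p.1 - monom k p.2 ∈
        Ideal.span {f | ∃ p ∈ 𝓑, f = monom k p.1 - monom k p.2} := by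
      intro p hp
      induction hp using AddSubmonoid.closure_induction with
      | mem x hx => exact Ideal.subset_span ⟨x, hx, rfl⟩
      | zero => simp
      | add x y hx hy h1 h2 =>
        have e : monom k (x + y).1 - monom k (x + y).2 =
            monom k x.1 * (monom k y.1 - monom k y.2) +
            monom k y.2 * (monom k x.1 - monom k x.2) := by
          rw [Prod.fst_add, Prod.snd_add, hadd, hadd]; ring
        rw [e]
        exact Ideal.add_mem _ (Ideal.mul_mem_left _ _ h2) (Ideal.mul_mem_left _ _ h1)
    refine key (fun i => (m i).toNat, fun i => (-(m i)).toNat) ?_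
    rw [← SetLike.mem_coe, hgen]
    have e : (fun i => (((m i).toNat : ℕ) : ℤ) - (((-(m i)).toNat : ℕ) : ℤ)) = m := by
      funext i; omega
    simpa only [Set.mem_setOf_eq, e] using hm
  · refine Ideal.span_le.2 ?_
    rintro f ⟨⟨a, b⟩, hp, rfl⟩
    have hL : (fun i => (a i : ℤ) - (b i : ℤ)) ∈ L := by
      have h := AddSubmonoid.subset_closure hp
      rw [hgen] at h
      exact h
    have ea : a = (fun i => min (a i) (b i)) + fun i => ((a i : ℤ) - (b i : ℤ)).toNat := by
      funext i; simp only [Pi.add_apply]; omega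
    have eb : b = (fun i => min (a i) (b i)) + fun i => (-((a i : ℤ) - (b i : ℤ))).toNat := by
      funext i; simp only [Pi.add_apply]; omega
    have e : monom k a - monom k b = monom k (fun i => min (a i) (b i)) *
        (monom k (fun i => ((a i : ℤ) - (b i : ℤ)).toNat) -
          monom k (fun i => (-((a i : ℤ) - (b i : ℤ))).toNat)) := by
      rw [mul_sub, ← hadd, ← hadd, ← ea, ← eb]
    change monom k a - monom k b ∈ latticeIdeal k L
    rw [e]
    exact Ideal.mul_mem_left _ _ (Ideal.subset_span ⟨_, hL, rfl⟩)
end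
end

section
/- Let k be a field. Let v₁, v₂, v₃ ∈ ℤ² be primitive vectors (the gcd of the two coordinates of each v_i is 1) such that 0 lies in the interior of the convex hull of {v₁, v₂, v₃} in ℝ² (so that v₁, v₂, v₃ generate a complete fan with three rays). Let L := {(⟨u, v₁⟩, ⟨u, v₂⟩, ⟨u, v₃⟩) : u ∈ ℤ²} ⊆ ℤ³ and let I_L ⊆ k[x₁, x₂, x₃] be the associated lattice ideal. Then I_L is not contained in the square of the maximal ideal ⟨x₁, x₂, x₃⟩ if and only if I_L is a complete intersection, i.e. there exist polynomials f, g with I_L = ⟨f, g⟩. -/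
open MvPolynomial

noncomputable section

/-- the binomial of a lattice vector -/
def bin (k : Type*) [CommRing k] (m : Fin 3 → ℤ) : MvPolynomial (Fin 3) k :=
  monom k (fun i => (m i).toNat) - monom k (fun i => (-(m i)).toNat)

lemma bin_neg (k : Type*) [CommRing k] (m : Fin 3 → ℤ) : bin k (-m) = - bin k m := by
  simp [bin]

lemma bin_mem {k : Type*} [CommRing k] {L : AddSubgroup (Fin 3 → ℤ)} {m : Fin 3 → ℤ}
    (hm : m ∈ L) : bin k m ∈ latticeIdeal k L :=
  Ideal.subset_span ⟨m, hm, rfl⟩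

lemma monom_eq (k : Type*) [CommRing k] (a : Fin 3 → ℕ) :
    monom k a = monomial (Finsupp.equivFunOnFinite.symm a) 1 := by
  rw [monom, monomial_eq, Finsupp.prod_fintype _ _ (by simp)]
  simp

lemma coeff_mono (k : Type*) [CommRing k] (a : Fin 3 → ℕ) (i : Fin 3) (c : ℕ)
    (u : Fin 3 →₀ ℕ) (r : k) :
    coeff (Finsupp.single i c) (monomial u r * monom k a) =
      if (∀ j, u j + a j = Finsupp.single i c j) then r else 0 := by
  rw [monom_eq, monomial_mul, coeff_monomial]
  simp [Finsupp.ext_iff]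

lemma coeff_mono' (k : Type*) [CommRing k] (a : Fin 3 → ℕ) (i : Fin 3) (c : ℕ) :
    coeff (Finsupp.single i c) (monom k a) =
      if (∀ j, a j = Finsupp.single i c j) then 1 else 0 := by
  rw [monom_eq, coeff_monomial]
  simp [Finsupp.ext_iff]

def IsMinC (L : AddSubgroup (Fin 3 → ℤ)) (i : Fin 3) (c : ℕ) : Prop :=
  ∀ m ∈ L, m i < c → (∀ j, j ≠ i → m j ≤ 0) → m = 0

lemma key_aux {L : AddSubgroup (Fin 3 → ℤ)} {i : Fin 3} {c : ℕ} (h : IsMinC L i c)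
    {m : Fin 3 → ℤ} (hm : m ∈ L) (u : Fin 3 →₀ ℕ) (hu : u ≠ 0)
    (hs : ∀ j, u j + (m j).toNat = Finsupp.single i c j) : m = 0 := by
  have hj : ∀ j, j ≠ i → u j = 0 ∧ m j ≤ 0 := by
    intro j hj
    have := hs j
    rw [Finsupp.single_eq_of_ne hj] at this
    omega
  have hui : u i ≠ 0 := by
    intro h0
    apply hu
    ext j
    by_cases hji : j = i
    · subst hji; simpa using h0
    · simpa using (hj j hji).1
  refine h m hm ?_ (fun j h => (hj j h).2)
  have := hs i
  rw [Finsupp.single_eq_same] at this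
  omega

lemma key {k : Type*} [Field k] {L : AddSubgroup (Fin 3 → ℤ)} {i : Fin 3} {c : ℕ}
    (h : IsMinC L i c) {p : MvPolynomial (Fin 3) k} (hp : p ∈ latticeIdeal k L) :
    ∀ q, coeff (Finsupp.single i c) (q * p) =
      constantCoeff q * coeff (Finsupp.single i c) p := by
  unfold latticeIdeal at hp
  induction hp using Submodule.span_induction with
  | mem x hx =>
    obtain ⟨m, hm, rfl⟩ := hx
    intro q
    induction q using MvPolynomial.induction_on' with
    | add p q hp hq => rw [add_mul, coeff_add, hp, hq, map_add, add_mul]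
    | monomial u r =>
      by_cases hu : u = 0
      · subst hu
        have : (monomial (0 : Fin 3 →₀ ℕ) r) = C r := rfl
        rw [this, coeff_C_mul, constantCoeff_C]
      · have hc : constantCoeff (monomial u r) = 0 := by
          rw [constantCoeff_monomial, if_neg hu]
        rw [hc, zero_mul]
        by_cases h0 : m = 0
        · subst h0; simp
        rw [mul_sub, coeff_sub, coeff_mono, coeff_mono, if_neg, if_neg, sub_zero]
        · intro hs
          apply h0
          have := key_aux h (L.neg_mem hm) u hu (by simpa using hs)
          simpa using this
        · intro hs
          exact h0 (key_aux h hm u hu hs)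
  | zero => simp
  | add x y _ _ hx hy =>
    intro q
    rw [mul_add, coeff_add, hx, hy, coeff_add, mul_add]
  | smul a x _ hx =>
    intro q
    rw [smul_eq_mul, ← mul_assoc, hx, hx, map_mul, mul_assoc]

lemma sum3 {M : Type*} [AddCommMonoid M] (f : Fin 3 → M) {i j l : Fin 3}
    (hij : i ≠ j) (hil : i ≠ l) (hjl : j ≠ l) : ∑ n, f n = f i + f j + f l := by
  have : (Finset.univ : Finset (Fin 3)) = {i, j, l} := by
    revert i j l; decide
  rw [this, Finset.sum_insert (by simp [hij, hil]), Finset.sum_insert (by simp [hjl]),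
    Finset.sum_singleton, add_assoc]

lemma prod3 {M : Type*} [CommMonoid M] (f : Fin 3 → M) {i j l : Fin 3}
    (hij : i ≠ j) (hil : i ≠ l) (hjl : j ≠ l) : ∏ n, f n = f i * f j * f l := by
  have : (Finset.univ : Finset (Fin 3)) = {i, j, l} := by
    revert i j l; decide
  rw [this, Finset.prod_insert (by simp [hij, hil]), Finset.prod_insert (by simp [hjl]),
    Finset.prod_singleton, mul_assoc]

lemma all3 {i j l : Fin 3} (hij : i ≠ j) (hil : i ≠ l) (hjl : j ≠ l) (n : Fin 3) :
    n = i ∨ n = j ∨ n = l := by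
  revert i j l n; decide

/-- lattice data -/
structure Good (L : AddSubgroup (Fin 3 → ℤ)) (w : Fin 3 → ℤ) : Prop where
  pos : ∀ i, 0 < w i
  orth : ∀ m ∈ L, ∑ i, w i * m i = 0
  ex : ∀ i j, i ≠ j → ∃ m ∈ L, 0 < m i ∧ m j < 0 ∧ ∀ l, l ≠ i → l ≠ j → m l = 0
  prim : ∀ i, ∃ m ∈ L, m i = 1

lemma Good.zero {L : AddSubgroup (Fin 3 → ℤ)} {w} (G : Good L w) {m} (hm : m ∈ L)
    (h : ∀ i, m i ≤ 0) : m = 0 := by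
  have h1 := G.orth m hm
  have h2 := (Finset.sum_eq_zero_iff_of_nonpos
    (fun i _ => mul_nonpos_of_nonneg_of_nonpos (G.pos i).le (h i))).1 h1
  ext i
  have := h2 i (Finset.mem_univ i)
  rcases mul_eq_zero.1 this with h | h
  · exact absurd h (G.pos i).ne'
  · exact h

lemma Good.exMin {L : AddSubgroup (Fin 3 → ℤ)} {w} (G : Good L w) (i : Fin 3) :
    ∃ c : ℕ, 0 < c ∧ IsMinC L i c ∧ ∃ m ∈ L, m i = c ∧ ∀ j, j ≠ i → m j ≤ 0 := by
  classical
  have hex : ∃ c : ℕ, 0 < c ∧ ∃ m ∈ L, m i = c ∧ ∀ j, j ≠ i → m j ≤ 0 := by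
    obtain ⟨j, hj⟩ : ∃ j, i ≠ j := by revert i; decide
    obtain ⟨m, hm, h1, h2, h3⟩ := G.ex i j hj
    refine ⟨(m i).toNat, by omega, m, hm, by omega, ?_⟩
    intro l hl
    by_cases hlj : l = j
    · subst hlj; exact h2.le
    · exact (h3 l hl hlj).le
  refine ⟨Nat.find hex, (Nat.find_spec hex).1, ?_, (Nat.find_spec hex).2⟩
  intro m hm hmi hmj
  by_cases h0 : m i ≤ 0
  · apply G.zero hm
    intro j
    by_cases h : j = i
    · subst h; exact h0
    · exact hmj j h
  · exfalso
    exact Nat.find_min hex (m := (m i).toNat) (by omega)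
      ⟨by omega, m, hm, by omega, hmj⟩

lemma Good.coin {L : AddSubgroup (Fin 3 → ℤ)} {w} (G : Good L w) {i j l : Fin 3}
    (hij : i ≠ j) (hil : i ≠ l) (hjl : j ≠ l) {ci cj cl : ℕ} (hci : 0 < ci)
    (hj : IsMinC L j cj) (hl : IsMinC L l cl) (h2 : 2 ≤ cl)
    {m} (hm : m ∈ L) (hmi : m i = ci) (hmj : m j = - (cj : ℤ)) (hml : m l = 0) : False := by
  obtain ⟨p, hp, hpl⟩ := G.prim l
  have hci' : (0 : ℤ) < ci := by exact_mod_cast hci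
  set q := p - (p i / ci) • m with hq
  have hqL : q ∈ L := L.sub_mem hp (L.zsmul_mem hm _)
  have hqi : q i = p i % ci := by
    have := Int.emod_add_mul_ediv (p i) ci
    simp only [hq, Pi.sub_apply, Pi.smul_apply, smul_eq_mul, hmi]
    linarith
  have hql : q l = 1 := by simp [hq, hml, hpl]
  have hqi0 : 0 ≤ q i := hqi ▸ Int.emod_nonneg _ hci'.ne'
  have hqi1 : q i < ci := hqi ▸ Int.emod_lt_of_pos _ hci'
  clear_value q
  have h3 : (cj : ℤ) ≤ - q j := by
    by_contra hlt
    have := hj (-q) (L.neg_mem hqL) (by simpa using hlt) (by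
      intro n hn
      rcases all3 hij hil hjl n with rfl | rfl | rfl
      · simpa using hqi0
      · exact absurd rfl hn
      · simp [hql])
    have := congrFun this l
    simp [hql] at this
  have := hl (q - m) (L.sub_mem hqL hm) (by simp [hql, hml]; omega) (by
      intro n hn
      rcases all3 hij hil hjl n with rfl | rfl | rfl
      · simp only [Pi.sub_apply]; omega
      · simp only [Pi.sub_apply]; omega
      · exact absurd rfl hn)
  have := congrFun this l
  simp [hql, hml] at this

lemma vars_eq (k : Type*) [Field k] :
    (Ideal.span {X 0, X 1, X 2} : Ideal (MvPolynomial (Fin 3) k)) = idealOfVars (Fin 3) k := by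
  rw [idealOfVars]
  congr 1
  ext x
  simp [Fin.exists_fin_succ, eq_comm]

lemma rank_contra {k : Type*} [Field k] (a b f g : Fin 3 → k)
    (h : ∀ i j, a i * f j + b i * g j = if i = j then 1 else 0) : False := by
  have h1 : (1 : Matrix (Fin 3) (Fin 3) k) =
      (Matrix.of fun i => ![a i, b i]) * (Matrix.of ![f, g]) := by
    ext i j
    simp [Matrix.mul_apply, Fin.sum_univ_two, h, Matrix.one_apply]
  have h2 := Matrix.rank_mul_le_left (Matrix.of fun i => ![a i, b i]) (Matrix.of ![f, g])
  rw [← h1, Matrix.rank_one] at h2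
  have h3 := Matrix.rank_le_card_width (Matrix.of fun i => ![a i, b i])
  simp at h2 h3
  omega

lemma Good.ci_imp {k : Type*} [Field k] {L : AddSubgroup (Fin 3 → ℤ)} {w} (G : Good L w)
    (f g : MvPolynomial (Fin 3) k) (hI : latticeIdeal k L = Ideal.span {f, g}) :
    ¬ latticeIdeal k L ≤ (Ideal.span {X 0, X 1, X 2} : Ideal (MvPolynomial (Fin 3) k)) ^ 2 := by
  intro hle
  choose c hc hmin m hm hmi hmj using G.exMin
  have hcoef : ∀ i j, coeff (Finsupp.single j (c j)) (monom k (fun n => (m i n).toNat)) =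
      if i = j then 1 else 0 := by
    intro i j
    rw [coeff_mono']
    congr 1
    refine propext ⟨?_, ?_⟩
    · intro h
      by_contra hij
      have := h i
      rw [Finsupp.single_eq_of_ne hij, hmi] at this
      have := hc i
      omega
    · rintro rfl n
      by_cases hn : n = i
      · subst hn; simp [hmi]
      · rw [Finsupp.single_eq_of_ne hn]
        have := hmj i n hn
        omega
  have hc2 : ∀ i, 2 ≤ c i := by
    intro i
    by_contra hlt
    have hci : c i = 1 := by have := hc i; omega
    have h1 := hle (bin_mem (k := k) (hm i))
    rw [vars_eq, mem_pow_idealOfVars_iff'] at h1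
    have h2 := h1 (Finsupp.single i (c i)) (by simp [hci])
    rw [bin, coeff_sub, hcoef, if_pos rfl, coeff_mono', if_neg, sub_zero] at h2
    · exact one_ne_zero h2
    · intro h
      have := h i
      rw [hmi] at this
      simp [hci] at this
  have hbin : ∀ i j, coeff (Finsupp.single j (c j)) (bin k (m i)) = if i = j then 1 else 0 := by
    intro i j
    rw [bin, coeff_sub, hcoef, coeff_mono', sub_eq_self]
    apply if_neg
    intro h
    by_cases hij : i = j
    · subst hij
      have := h i
      rw [hmi, Finsupp.single_eq_same] at this
      have := hc i
      omega
    · obtain ⟨l, hil, hjl⟩ : ∃ l, i ≠ l ∧ j ≠ l := by clear h hij; revert i j; decide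
      refine G.coin hij hil hjl (hc i) (hmin j) (hmin l) (hc2 l) (hm i) (hmi i) ?_ ?_
      · have := h j
        rw [Finsupp.single_eq_same] at this
        have := hc j
        omega
      · have := h l
        rw [Finsupp.single_eq_of_ne (Ne.symm hjl)] at this
        have := hmj i l hil.symm
        omega
  have hfL : f ∈ latticeIdeal k L := hI ▸ Ideal.subset_span (by simp)
  have hgL : g ∈ latticeIdeal k L := hI ▸ Ideal.subset_span (by simp)
  have hrep : ∀ i, ∃ a b, a * f + b * g = bin k (m i) := fun i => by
    have := bin_mem (k := k) (hm i)
    rw [hI] at this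
    exact Ideal.mem_span_pair.1 this
  choose a b hab using hrep
  refine rank_contra (fun i => constantCoeff (a i)) (fun i => constantCoeff (b i))
    (fun j => coeff (Finsupp.single j (c j)) f) (fun j => coeff (Finsupp.single j (c j)) g) ?_
  intro i j
  rw [← hbin i j, ← hab, coeff_add, key (hmin j) hfL, key (hmin j) hgL]

lemma mono_rel {Q : Type*} [CommRing Q] (x y z : Q) (b c p q : ℕ) (hx : x = y ^ b * z ^ c)
    (hy : y ^ p = z ^ q) (t : ℕ) (A A' B B' C C' : ℕ)
    (h1 : b * A + B = b * A' + B' + t * p) (h2 : c * A' + C' = c * A + C + t * q) :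
    x ^ A * y ^ B * z ^ C = x ^ A' * y ^ B' * z ^ C' := by
  have e : ∀ A B C, x ^ A * y ^ B * z ^ C = y ^ (b * A + B) * z ^ (c * A + C) := by
    intro A B C
    rw [hx, mul_pow, ← pow_mul, ← pow_mul]; ring
  rw [e, e, h1, h2, pow_add _ _ (t * p), pow_add _ _ (t * q), mul_comm t p, mul_comm t q,
    pow_mul y p, pow_mul z q, hy]
  ring

lemma bin_eq3 {k : Type*} [Field k] (m : Fin 3 → ℤ) {i j l : Fin 3}
    (hij : i ≠ j) (hil : i ≠ l) (hjl : j ≠ l) :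
    bin k m = X i ^ (m i).toNat * X j ^ (m j).toNat * X l ^ (m l).toNat
      - X i ^ (-m i).toNat * X j ^ (-m j).toNat * X l ^ (-m l).toNat := by
  rw [bin, monom, monom, prod3 _ hij hil hjl, prod3 _ hij hil hjl]

lemma Good.exGen {L : AddSubgroup (Fin 3 → ℤ)} {w} (G : Good L w) {i j l : Fin 3}
    (hij : i ≠ j) (hil : i ≠ l) (hjl : j ≠ l) :
    ∃ m ∈ L, m i = 0 ∧ 0 < m j ∧ m l < 0 ∧ ∀ n ∈ L, n i = 0 → ∃ t : ℤ, n = t • m := by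
  classical
  have hex : ∃ c : ℕ, 0 < c ∧ ∃ m ∈ L, m j = c ∧ m i = 0 := by
    obtain ⟨m, hm, h1, h2, h3⟩ := G.ex j l hjl
    exact ⟨(m j).toNat, by omega, m, hm, by omega, h3 i hij hil⟩
  obtain ⟨hc, m, hm, hmj, hmi⟩ := Nat.find_spec hex
  have hmin := fun n => Nat.find_min hex (m := n)
  set c := Nat.find hex
  clear_value c
  refine ⟨m, hm, hmi, by omega, ?_, ?_⟩
  · have h1 := G.orth m hm
    rw [sum3 _ hij hil hjl, hmi] at h1
    have := G.pos j
    have := G.pos l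
    have h4 : 0 < m j := by omega
    nlinarith [mul_pos (G.pos j) h4]
  · intro n hn hni
    have hc' : (0 : ℤ) < c := by exact_mod_cast hc
    refine ⟨n j / c, ?_⟩
    set r := n - (n j / c) • m with hr
    have hrL : r ∈ L := L.sub_mem hn (L.zsmul_mem hm _)
    have hri : r i = 0 := by simp [hr, hni, hmi]
    have hrj : r j = n j % c := by
      have := Int.emod_add_mul_ediv (n j) c
      simp only [hr, Pi.sub_apply, Pi.smul_apply, smul_eq_mul, hmj]
      linarith
    have h0 := Int.emod_nonneg (n j) hc'.ne'
    have h1 := Int.emod_lt_of_pos (n j) hc'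
    have hrj0 : r j = 0 := by
      by_contra hne
      exact hmin (r j).toNat (by omega) ⟨by omega, r, hrL, by omega, hri⟩
    have hrl : r l = 0 := by
      have h1 := G.orth r hrL
      rw [sum3 _ hij hil hjl, hri, hrj0] at h1
      have := G.pos l
      simp at h1
      rcases h1 with h | h
      · omega
      · exact h
    have : r = 0 := by
      ext s
      rcases all3 hij hil hjl s with rfl | rfl | rfl <;> simpa
    exact sub_eq_zero.1 (hr ▸ this)

lemma Good.imp_ci_aux {k : Type*} [Field k] {L : AddSubgroup (Fin 3 → ℤ)} {w} (G : Good L w)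
    {i j l : Fin 3} (hij : i ≠ j) (hil : i ≠ l) (hjl : j ≠ l) {m} (hm : m ∈ L)
    (hmi : m i = 1) (hmj : m j ≤ 0) (hml : m l ≤ 0) :
    ∃ f g : MvPolynomial (Fin 3) k, latticeIdeal k L = Ideal.span {f, g} := by
  obtain ⟨v, hv, hvi, hvj, hvl, hgen⟩ := G.exGen hij hil hjl
  refine ⟨bin k m, bin k v, le_antisymm ?_ ?_⟩
  swap
  · rw [Ideal.span_le]
    rintro x (rfl | rfl)
    · exact bin_mem hm
    · exact bin_mem hv
  unfold latticeIdeal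
  rw [Ideal.span_le]
  rintro x ⟨n, hn, rfl⟩
  change bin k n ∈ Ideal.span _
  obtain ⟨b, hb⟩ := Int.eq_ofNat_of_zero_le (neg_nonneg.2 hmj)
  obtain ⟨c, hc⟩ := Int.eq_ofNat_of_zero_le (neg_nonneg.2 hml)
  obtain ⟨p, hp⟩ := Int.eq_ofNat_of_zero_le hvj.le
  obtain ⟨q, hq⟩ := Int.eq_ofNat_of_zero_le (neg_nonneg.2 hvl.le)
  have hmj' : (m j) = -(b : ℤ) := by omega
  have hml' : (m l) = -(c : ℤ) := by omega
  have hvl' : (v l) = -(q : ℤ) := by omega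
  set J : Ideal (MvPolynomial (Fin 3) k) := Ideal.span {bin k m, bin k v} with hJ
  have h1 : Ideal.Quotient.mk J (bin k m) = 0 :=
    Ideal.Quotient.eq_zero_iff_mem.2 (Ideal.subset_span (by simp))
  have h2 : Ideal.Quotient.mk J (bin k v) = 0 :=
    Ideal.Quotient.eq_zero_iff_mem.2 (Ideal.subset_span (by simp))
  rw [bin_eq3 _ hij hil hjl, hmi, hmj', hml'] at h1
  rw [bin_eq3 _ hij hil hjl, hvi, hp, hvl'] at h2
  simp [sub_eq_zero] at h1 h2
  rw [← Ideal.Quotient.eq_zero_iff_mem, bin_eq3 _ hij hil hjl]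
  simp only [map_sub, map_mul, map_pow, sub_eq_zero]
  obtain ⟨t, ht⟩ := hgen (n - n i • m) (L.sub_mem hn (L.zsmul_mem hm _)) (by simp [hmi])
  have e1 := congrFun ht j
  have e2 := congrFun ht l
  simp only [Pi.sub_apply, Pi.smul_apply, smul_eq_mul, hmj', hml', hp, hvl'] at e1 e2
  have d : ∀ z : ℤ, ((z.toNat : ℕ) : ℤ) = z + ((-z).toNat : ℕ) := by intro z; omega
  have di := d (n i)
  have dj := d (n j)
  have dl := d (n l)
  rcases le_total 0 t with h0 | h0
  · obtain ⟨s, rfl⟩ := Int.eq_ofNat_of_zero_le h0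
    apply mono_rel _ _ _ b c p q h1 h2 s
    · zify; rw [di, dj]; linear_combination e1
    · zify; rw [di, dl]; linear_combination -e2
  · obtain ⟨s, hs⟩ := Int.eq_ofNat_of_zero_le (neg_nonneg.2 h0)
    have hs' : t = -(s : ℤ) := by omega
    subst hs'
    symm
    apply mono_rel _ _ _ b c p q h1 h2 s
    · zify; rw [di, dj]; linear_combination -e1
    · zify; rw [di, dl]; linear_combination e2

lemma monom_mem {k : Type*} [Field k] (a : Fin 3 → ℕ) (h : 2 ≤ ∑ i, a i) :
    monom k a ∈ (Ideal.span {X 0, X 1, X 2} : Ideal (MvPolynomial (Fin 3) k)) ^ 2 := by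
  rw [vars_eq, mem_pow_idealOfVars_iff', monom_eq]
  intro x hx
  rw [coeff_monomial, if_neg]
  rintro rfl
  rw [Finsupp.degree_eq_sum] at hx
  simp at hx
  omega

lemma Good.imp_ci_aux2 {k : Type*} [Field k] {L : AddSubgroup (Fin 3 → ℤ)} {w} (G : Good L w)
    {m} (hm : m ∈ L) (h0 : m ≠ 0) (hs : ∑ i, (m i).toNat < 2) :
    ∃ f g : MvPolynomial (Fin 3) k, latticeIdeal k L = Ideal.span {f, g} := by
  have : ∃ i, 0 < m i := by
    by_contra! h
    exact h0 (G.zero hm h)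
  obtain ⟨i, hi⟩ := this
  obtain ⟨j, l, hij, hil, hjl⟩ : ∃ j l, i ≠ j ∧ i ≠ l ∧ j ≠ l := by
    clear hi; revert i; decide
  rw [sum3 _ hij hil hjl] at hs
  exact G.imp_ci_aux hij hil hjl hm (by omega) (by omega) (by omega)

lemma Good.imp_ci {k : Type*} [Field k] {L : AddSubgroup (Fin 3 → ℤ)} {w} (G : Good L w)
    (h : ¬ latticeIdeal k L ≤
      (Ideal.span {X 0, X 1, X 2} : Ideal (MvPolynomial (Fin 3) k)) ^ 2) :
    ∃ f g : MvPolynomial (Fin 3) k, latticeIdeal k L = Ideal.span {f, g} := by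
  by_contra hno
  apply h
  unfold latticeIdeal
  rw [Ideal.span_le]
  rintro x ⟨m, hm, rfl⟩
  by_cases h0 : m = 0
  · subst h0; simp
  refine Ideal.sub_mem _ (monom_mem _ ?_) (monom_mem _ ?_)
  · by_contra hlt
    exact hno (G.imp_ci_aux2 hm h0 (by omega))
  · by_contra hlt
    exact hno (G.imp_ci_aux2 (L.neg_mem hm) (neg_ne_zero.2 h0) (by simpa using hlt))

lemma fan_pos (S : Set (Fin 2 → ℝ)) (h : (0 : Fin 2 → ℝ) ∈ interior (convexHull ℝ S))
    (a b : ℝ) (hab : a ≠ 0 ∨ b ≠ 0) : ∃ v ∈ S, 0 < a * v 0 + b * v 1 := by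
  by_contra! hno
  have hconv : Convex ℝ {v : Fin 2 → ℝ | a * v 0 + b * v 1 ≤ 0} := by
    apply convex_halfSpace_le (f := fun v : Fin 2 → ℝ => a * v 0 + b * v 1)
    constructor
    · intro x y; simp; ring
    · intro c x; simp; ring
  have hsub : convexHull ℝ S ⊆ {v : Fin 2 → ℝ | a * v 0 + b * v 1 ≤ 0} :=
    convexHull_min hno hconv
  have hev : ∀ᶠ v in nhds (0 : Fin 2 → ℝ), a * v 0 + b * v 1 ≤ 0 :=
    Filter.mem_of_superset (mem_interior_iff_mem_nhds.1 h) hsub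
  have ht : Filter.Tendsto (fun t : ℝ => (![t * a, t * b] : Fin 2 → ℝ))
      (nhdsWithin 0 (Set.Ioi 0)) (nhds 0) := by
    have : Continuous (fun t : ℝ => (![t * a, t * b] : Fin 2 → ℝ)) := by fun_prop
    have h2 := this.tendsto 0
    have h3 : (![(0:ℝ) * a, 0 * b] : Fin 2 → ℝ) = 0 := by ext i; fin_cases i <;> simp
    rw [h3] at h2
    exact h2.mono_left nhdsWithin_le_nhds
  obtain ⟨t, h1, h2⟩ := ((ht.eventually hev).and self_mem_nhdsWithin).exists
  simp at h1 h2
  have : 0 < a ^ 2 + b ^ 2 := by rcases hab with h | h <;> positivity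
  nlinarith [mul_pos h2 this]

lemma fan_sign (u v w : Fin 2 → ℤ) (hu : Int.gcd (u 0) (u 1) = 1)
    (hfan : (0 : Fin 2 → ℝ) ∈ interior (convexHull ℝ
      ({(fun i => (u i : ℝ)), (fun i => (v i : ℝ)), (fun i => (w i : ℝ))} :
        Set (Fin 2 → ℝ)))) :
    (u 0 * v 1 - u 1 * v 0) * (w 0 * u 1 - w 1 * u 0) > 0 := by
  have hne : u 0 ≠ 0 ∨ u 1 ≠ 0 := by
    by_contra! h
    rw [h.1, h.2] at hu
    simp at hu
  have k1 := fan_pos _ hfan (-(u 1 : ℝ)) (u 0 : ℝ) (by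
    rcases hne with h | h
    · right; exact_mod_cast h
    · left; simpa using h)
  have k2 := fan_pos _ hfan ((u 1 : ℝ)) (-(u 0 : ℝ)) (by
    rcases hne with h | h
    · right; simpa using h
    · left; simpa using h)
  simp only [Set.mem_insert_iff, Set.mem_singleton_iff, exists_eq_or_imp, exists_eq_left] at k1 k2
  norm_cast at k1 k2
  have c1 : 0 < u 0 * v 1 - u 1 * v 0 ∨ w 0 * u 1 - w 1 * u 0 < 0 := by
    rcases k1 with h | h | h
    · exfalso; linarith [mul_comm (u 0) (u 1)]
    · left; linarith
    · right; linarith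
  have c2 : u 0 * v 1 - u 1 * v 0 < 0 ∨ 0 < w 0 * u 1 - w 1 * u 0 := by
    rcases k2 with h | h | h
    · exfalso; linarith [mul_comm (u 0) (u 1)]
    · left; linarith
    · right; linarith
  rcases c1 with h | h <;> rcases c2 with h' | h'
  · omega
  · exact mul_pos h h'
  · exact mul_pos_of_neg_of_neg h' h
  · omega

lemma good_of (v₁ v₂ v₃ : Fin 2 → ℤ)
    (hprim₁ : Int.gcd (v₁ 0) (v₁ 1) = 1)
    (hprim₂ : Int.gcd (v₂ 0) (v₂ 1) = 1)
    (hprim₃ : Int.gcd (v₃ 0) (v₃ 1) = 1)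
    (hfan : (0 : Fin 2 → ℝ) ∈ interior (convexHull ℝ
      ({(fun i => (v₁ i : ℝ)), (fun i => (v₂ i : ℝ)), (fun i => (v₃ i : ℝ))} :
        Set (Fin 2 → ℝ))))
    (L : AddSubgroup (Fin 3 → ℤ))
    (hL : ∀ m : Fin 3 → ℤ, m ∈ L ↔ ∃ u : Fin 2 → ℤ,
      m = ![u 0 * v₁ 0 + u 1 * v₁ 1,
            u 0 * v₂ 0 + u 1 * v₂ 1,
            u 0 * v₃ 0 + u 1 * v₃ 1]) : ∃ w, Good L w := by
  have s1 := fan_sign v₁ v₂ v₃ hprim₁ hfan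
  have s2 := fan_sign v₂ v₃ v₁ hprim₂ (by
    refine Eq.mp (congrArg (fun S => (0 : Fin 2 → ℝ) ∈ interior (convexHull ℝ S)) ?_) hfan
    ext x; simp only [Set.mem_insert_iff, Set.mem_singleton_iff]; tauto)
  obtain ⟨a3, h3⟩ : ∃ a, a = v₁ 0 * v₂ 1 - v₁ 1 * v₂ 0 := ⟨_, rfl⟩
  obtain ⟨a2, h2⟩ : ∃ a, a = v₃ 0 * v₁ 1 - v₃ 1 * v₁ 0 := ⟨_, rfl⟩
  obtain ⟨a1, h1⟩ : ∃ a, a = v₂ 0 * v₃ 1 - v₂ 1 * v₃ 0 := ⟨_, rfl⟩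
  rw [← h3, ← h2] at s1
  rw [← h1, ← h3] at s2
  obtain ⟨e, he, p1, p2, p3⟩ : ∃ e : ℤ, (e = 1 ∨ e = -1) ∧ 0 < e * a1 ∧ 0 < e * a2 ∧ 0 < e * a3 := by
    rcases lt_trichotomy a3 0 with h | h | h
    · exact ⟨-1, by simp, by nlinarith, by nlinarith, by nlinarith⟩
    · simp [h] at s1
    · exact ⟨1, by simp, by nlinarith, by nlinarith, by nlinarith⟩
  have m12 : ![e * a2, -(e * a1), 0] ∈ L := (hL _).2 ⟨![-e * v₃ 1, e * v₃ 0], by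
    subst h1 h2 h3; ext i; fin_cases i <;> simp <;> ring⟩
  have m23 : ![0, e * a3, -(e * a2)] ∈ L := (hL _).2 ⟨![-e * v₁ 1, e * v₁ 0], by
    subst h1 h2 h3; ext i; fin_cases i <;> simp <;> ring⟩
  have m31 : ![-(e * a3), 0, e * a1] ∈ L := (hL _).2 ⟨![-e * v₂ 1, e * v₂ 0], by
    subst h1 h2 h3; ext i; fin_cases i <;> simp <;> ring⟩
  refine ⟨![e * a1, e * a2, e * a3], ?_, ?_, ?_, ?_⟩
  · intro i; fin_cases i <;> simpa
  · intro m hm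
    obtain ⟨u, rfl⟩ := (hL _).1 hm
    subst h1 h2 h3
    simp [Fin.sum_univ_three]
    ring
  · intro i j hij
    fin_cases i <;> fin_cases j <;> simp at hij
    · exact ⟨_, m12, by simpa, by simpa, by intro l; fin_cases l <;> simp⟩
    · exact ⟨_, L.neg_mem m31, by simpa, by simpa, by intro l; fin_cases l <;> simp⟩
    · exact ⟨_, L.neg_mem m12, by simpa, by simpa, by intro l; fin_cases l <;> simp⟩
    · exact ⟨_, m23, by simpa, by simpa, by intro l; fin_cases l <;> simp⟩
    · exact ⟨_, m31, by simpa, by simpa, by intro l; fin_cases l <;> simp⟩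
    · exact ⟨_, L.neg_mem m23, by simpa, by simpa, by intro l; fin_cases l <;> simp⟩
  · have bez : ∀ v : Fin 2 → ℤ, Int.gcd (v 0) (v 1) = 1 →
        ∃ u : Fin 2 → ℤ, u 0 * v 0 + u 1 * v 1 = 1 := by
      intro v hv
      obtain ⟨a, b, h⟩ := Int.isCoprime_iff_gcd_eq_one.2 hv
      exact ⟨![a, b], by simpa using h⟩
    intro i
    fin_cases i
    · obtain ⟨u, hu⟩ := bez v₁ hprim₁
      exact ⟨_, (hL _).2 ⟨u, rfl⟩, by simpa using hu⟩
    · obtain ⟨u, hu⟩ := bez v₂ hprim₂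
      exact ⟨_, (hL _).2 ⟨u, rfl⟩, by simpa using hu⟩
    · obtain ⟨u, hu⟩ := bez v₃ hprim₃
      exact ⟨_, (hL _).2 ⟨u, rfl⟩, by simpa using hu⟩

/-- Let `v₁, v₂, v₃ ∈ ℤ²` be primitive vectors such that `0` lies in the interior of
the convex hull of `{v₁, v₂, v₃}` in `ℝ²`, let `L ⊆ ℤ³` be the image of `ℤ²` under
`u ↦ (⟨u, v₁⟩, ⟨u, v₂⟩, ⟨u, v₃⟩)`, and let `I_L ⊆ k[x₁, x₂, x₃]` be the associated
lattice ideal. Then `I_L ⊄ ⟨x₁, x₂, x₃⟩²` if and only if `I_L` is a complete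
intersection. -/
theorem latticeIdeal_not_in_sq_iff_complete_intersection (k : Type*) [Field k]
    (v₁ v₂ v₃ : Fin 2 → ℤ)
    (hprim₁ : Int.gcd (v₁ 0) (v₁ 1) = 1)
    (hprim₂ : Int.gcd (v₂ 0) (v₂ 1) = 1)
    (hprim₃ : Int.gcd (v₃ 0) (v₃ 1) = 1)
    (hfan : (0 : Fin 2 → ℝ) ∈ interior (convexHull ℝ
      ({(fun i => (v₁ i : ℝ)), (fun i => (v₂ i : ℝ)), (fun i => (v₃ i : ℝ))} :
        Set (Fin 2 → ℝ))))
    (L : AddSubgroup (Fin 3 → ℤ))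
    (hL : ∀ m : Fin 3 → ℤ, m ∈ L ↔ ∃ u : Fin 2 → ℤ,
      m = ![u 0 * v₁ 0 + u 1 * v₁ 1,
            u 0 * v₂ 0 + u 1 * v₂ 1,
            u 0 * v₃ 0 + u 1 * v₃ 1]) :
    ¬ latticeIdeal k L ≤
        (Ideal.span {X 0, X 1, X 2} : Ideal (MvPolynomial (Fin 3) k)) ^ 2 ↔
      ∃ f g : MvPolynomial (Fin 3) k, latticeIdeal k L = Ideal.span {f, g} := by
  obtain ⟨w, G⟩ := good_of v₁ v₂ v₃ hprim₁ hprim₂ hprim₃ hfan L hL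
  exact ⟨G.imp_ci, fun ⟨f, g, h⟩ => G.ci_imp f g h⟩
end
end
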